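/- Let r > 0 and suppose L(θ,ξ) is Lipschitz continuous in ξ with Lipschitz constant Λ > 0 uniformly across all θ ∈ Θ. Then for every θ ∈ Θ and every P' ∈ Π: R(θ,P') ≤ R*(θ,P') ≤ R(θ,P') + Λ · diam(Ξ) · √(r/2), where diam(Ξ) = max_{ξ,ξ'∈Ξ} ‖ξ − ξ'‖₂. -/

import Mathlib

open MeasureTheory Filter Topology ProbabilityTheory
open scoped ENNReal NNReal RealInnerProductSpace

noncomputable section
open scoped Classical

/-- The relative entropy (Kullback–Leibler divergence) `D(Q‖P)`, equal to
`∫ log (dQ/dP) dQ` if `Q ≪ P` and this integral is well defined, and `+∞` otherwise. -/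
def relEntropy {Ω : Type*} [MeasurableSpace Ω] (Q P : Measure Ω) : ℝ≥0∞ :=
  if Q ≪ P ∧ Integrable (fun x => Real.log (Q.rnDeriv P x).toReal) Q
  then ENNReal.ofReal (∫ x, Real.log (Q.rnDeriv P x).toReal ∂Q)
  else ⊤

variable {Ω : Type*} [MeasurableSpace Ω] {d n : ℕ}

/-- The family `Π = {Q ∈ 𝒫(Ξ) : E_Q[ψ] ∈ E}`. -/
def PiSet (psi : Ω → EuclideanSpace ℝ (Fin d)) (E : Set (EuclideanSpace ℝ (Fin d))) :
    Set (ProbabilityMeasure Ω) :=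
  {Q | (∫ x, psi x ∂(Q : Measure Ω)) ∈ E}

/-- The risk `R(θ, Q) = E_Q[L(θ, ·)]`. -/
def Rrisk (Lf : EuclideanSpace ℝ (Fin n) → Ω → ℝ) (θ : EuclideanSpace ℝ (Fin n))
    (Q : ProbabilityMeasure Ω) : ℝ :=
  ∫ x, Lf θ x ∂(Q : Measure Ω)

/-- The DRO predictor `R⋆(θ, P') = sup {R(θ, Q) : Q ∈ Π, D(P'‖Q) ≤ r}`. -/
def Rstar (psi : Ω → EuclideanSpace ℝ (Fin d)) (E : Set (EuclideanSpace ℝ (Fin d)))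
    (Lf : EuclideanSpace ℝ (Fin n) → Ω → ℝ) (r : ℝ) (θ : EuclideanSpace ℝ (Fin n))
    (P' : ProbabilityMeasure Ω) : ℝ :=
  sSup ((fun Q : ProbabilityMeasure Ω => Rrisk Lf θ Q) ''
    {Q | Q ∈ PiSet psi E ∧ relEntropy (P' : Measure Ω) (Q : Measure Ω) ≤ ENNReal.ofReal r})

theorem empirical_isProbabilityMeasure (x : ℕ → Ω) {N : ℕ} (hN : N ≠ 0) :
    IsProbabilityMeasure ((N : ℝ≥0∞)⁻¹ • ∑ i ∈ Finset.range N, Measure.dirac (x i)) := by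
  constructor
  simp only [Measure.smul_apply, Measure.finset_sum_apply, measure_univ, Finset.sum_const,
    Finset.card_range, nsmul_eq_mul, mul_one, smul_eq_mul]
  exact ENNReal.inv_mul_cancel (by exact_mod_cast hN) (ENNReal.natCast_ne_top N)

/-- The empirical distribution `P̂_N = (1/N) ∑_{i<N} δ_{ω i}` of the first `N` samples
(junk value `δ_{ω 0}` for `N = 0`). -/
def empPM (ω : ℕ → Ω) (N : ℕ) : ProbabilityMeasure Ω :=
  if h : N = 0 then ⟨Measure.dirac (ω 0), inferInstance⟩
  else ⟨(N : ℝ≥0∞)⁻¹ • ∑ i ∈ Finset.range N, Measure.dirac (ω i),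
    empirical_isProbabilityMeasure ω h⟩

/-- The Donsker–Varadhan inequality for the log-likelihood ratio. -/
theorem integral_le_integral_llr_add_log_integral_exp {α : Type*} [MeasurableSpace α]
    {P Q : Measure α} [IsProbabilityMeasure P] [IsProbabilityMeasure Q] (hPQ : P ≪ Q)
    (hllr : Integrable (llr P Q) P) {g : α → ℝ} (hg : Integrable g P)
    (hexp : Integrable (fun x => Real.exp (g x)) Q) :
    ∫ x, g x ∂P ≤ ∫ x, llr P Q x ∂P + Real.log (∫ x, Real.exp (g x) ∂Q) := by
  have := isProbabilityMeasure_tilted hexp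
  have h := InformationTheory.integral_llr_add_sub_measure_univ_nonneg
    (hPQ.trans (absolutelyContinuous_tilted hexp)) (integrable_llr_tilted_right hPQ hg hllr hexp)
  rw [integral_llr_tilted_right hPQ hg hexp hllr, probReal_univ, probReal_univ] at h
  linarith

/-- The Pinsker-type bound on the difference of the means of a bounded function under two
probability measures. -/
theorem integral_sub_integral_le_of_mem_Icc {α : Type*} [MeasurableSpace α]
    {P Q : Measure α} [IsProbabilityMeasure P] [IsProbabilityMeasure Q] (hPQ : P ≪ Q)
    (hllr : Integrable (llr P Q) P) {f : α → ℝ} (hf : Measurable f) {a b : ℝ} (hab : a ≤ b)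
    (hfab : ∀ x, f x ∈ Set.Icc a b) :
    ∫ x, f x ∂Q - ∫ x, f x ∂P ≤ (b - a) * Real.sqrt ((∫ x, llr P Q x ∂P) / 2) := by
  have hsub := hasSubgaussianMGF_of_mem_Icc (μ := Q) hf.aemeasurable (ae_of_all _ hfab)
  have hfP : Integrable f P := Integrable.of_mem_Icc a b hf.aemeasurable (ae_of_all _ hfab)
  set K := ∫ x, llr P Q x ∂P
  set δ := ∫ x, f x ∂Q - ∫ x, f x ∂P with hδ
  have quad (s : ℝ) : 0 ≤ ((b - a) ^ 2 / 8) * (s * s) + δ * s + K := by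
    have hdv := integral_le_integral_llr_add_log_integral_exp hPQ hllr
      (g := fun x => s * (f x - ∫ y, f y ∂Q)) ((hfP.sub (integrable_const _)).const_mul s)
      (hsub.integrable_exp_mul s)
    have hcgf := hsub.cgf_le s
    simp only [cgf, mgf] at hcgf
    rw [integral_const_mul, integral_sub hfP (integrable_const _)] at hdv
    simp only [NNReal.coe_pow, NNReal.coe_div, coe_nnnorm, Real.norm_eq_abs, div_pow, sq_abs,
      NNReal.coe_ofNat] at hcgf
    simp only [integral_const, probReal_univ, smul_eq_mul, one_mul] at hdv
    linarith
  have hdisc := discrim_le_zero quad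
  rw [discrim] at hdisc
  calc δ ≤ Real.sqrt ((b - a) ^ 2 * (K / 2)) := Real.le_sqrt_of_sq_le (by linarith)
    _ = (b - a) * Real.sqrt (K / 2) := by
      rw [Real.sqrt_mul (sq_nonneg _), Real.sqrt_sq (sub_nonneg.2 hab)]

theorem relEntropy_self {α : Type*} [MeasurableSpace α] (P : Measure α) [SigmaFinite P] :
    relEntropy P P = 0 := by
  have h : (fun x => Real.log (P.rnDeriv P x).toReal) =ᵐ[P] 0 := llr_self P
  rw [relEntropy, if_pos ⟨Measure.AbsolutelyContinuous.rfl,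
    (integrable_congr h).2 (integrable_zero _ _ _)⟩, integral_congr_ae h]
  simp

theorem integral_llr_le_of_relEntropy_le {α : Type*} [MeasurableSpace α] {P Q : Measure α} {r : ℝ}
    (hr : 0 ≤ r) (h : relEntropy P Q ≤ ENNReal.ofReal r) :
    P ≪ Q ∧ Integrable (llr P Q) P ∧ ∫ x, llr P Q x ∂P ≤ r := by
  rw [relEntropy] at h
  split_ifs at h with hac
  · exact ⟨hac.1, hac.2, (ENNReal.ofReal_le_ofReal_iff hr).1 h⟩
  · simp at h

/-- **Sandwich bound for the DRO predictor.**  If `r > 0` and `L(θ,·)` is `Λ`-Lipschitz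
uniformly over `θ ∈ Θ`, then for every `θ ∈ Θ` and `P' ∈ Π`:
`R(θ,P') ≤ R⋆(θ,P') ≤ R(θ,P') + Λ · diam(Ξ) · √(r/2)`. -/
theorem statement16 {m d n : ℕ}
    (Xi : Set (EuclideanSpace ℝ (Fin m))) (hXi : IsCompact Xi) (hXiNe : Xi.Nonempty)
    (psi : ↥Xi → EuclideanSpace ℝ (Fin d)) (hpsi : Continuous psi)
    (E : Set (EuclideanSpace ℝ (Fin d))) (hE : IsCompact E) (hEconv : Convex ℝ E)
    (hEne : E.Nonempty)
    (Θ : Set (EuclideanSpace ℝ (Fin n))) (hΘ : IsCompact Θ) (hΘne : Θ.Nonempty)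
    (Lf : EuclideanSpace ℝ (Fin n) → ↥Xi → ℝ)
    (hL : ContinuousOn (fun p : EuclideanSpace ℝ (Fin n) × ↥Xi => Lf p.1 p.2)
      (Θ ×ˢ (Set.univ : Set ↥Xi)))
    (r : ℝ) (hr : 0 < r)
    (Λ : ℝ) (hΛ : 0 < Λ)
    (hLip : ∀ θ ∈ Θ, ∀ x y : ↥Xi, |Lf θ x - Lf θ y| ≤ Λ * dist x y) :
    ∀ θ ∈ Θ, ∀ P' ∈ PiSet psi E,
      Rrisk Lf θ P' ≤ Rstar psi E Lf r θ P' ∧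
      Rstar psi E Lf r θ P' ≤ Rrisk Lf θ P' + Λ * Metric.diam Xi * Real.sqrt (r / 2) := by
  intro θ hθ P' hP'
  have : CompactSpace Xi := isCompact_iff_compactSpace.1 hXi
  have : Nonempty Xi := hXiNe.to_subtype
  have hcont : Continuous (Lf θ) :=
    (LipschitzWith.of_dist_le_mul (K := ⟨Λ, hΛ.le⟩) (hLip θ hθ)).continuous
  obtain ⟨x₀, -, hx₀⟩ := isCompact_univ.exists_isMinOn Set.univ_nonempty hcont.continuousOn
  have hdiam : 0 ≤ Λ * Metric.diam Xi := mul_nonneg hΛ.le Metric.diam_nonneg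
  have hmem (x : Xi) : Lf θ x ∈ Set.Icc (Lf θ x₀) (Lf θ x₀ + Λ * Metric.diam Xi) := by
    refine ⟨hx₀ (Set.mem_univ x), ?_⟩
    have hdist : dist x x₀ ≤ Metric.diam Xi :=
      Metric.dist_le_diam_of_mem hXi.isBounded x.2 x₀.2
    linarith [(le_abs_self _).trans (hLip θ hθ x x₀), mul_le_mul_of_nonneg_left hdist hΛ.le]
  have hub : ∀ y ∈ (fun Q : ProbabilityMeasure Xi => Rrisk Lf θ Q) ''
      {Q | Q ∈ PiSet psi E ∧
        relEntropy (P' : Measure Xi) (Q : Measure Xi) ≤ ENNReal.ofReal r},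
      y ≤ Rrisk Lf θ P' + Λ * Metric.diam Xi * Real.sqrt (r / 2) := by
    rintro _ ⟨Q, ⟨-, hQ⟩, rfl⟩
    obtain ⟨hac, hint, hle⟩ := integral_llr_le_of_relEntropy_le hr.le hQ
    have h := integral_sub_integral_le_of_mem_Icc hac hint hcont.measurable
      (le_add_of_nonneg_right hdiam) hmem
    rw [add_sub_cancel_left] at h
    have hsqrt := mul_le_mul_of_nonneg_left (Real.sqrt_le_sqrt
      (div_le_div_of_nonneg_right hle zero_le_two)) hdiam
    simp only [Rrisk]
    linarith
  have hself : Rrisk Lf θ P' ∈ (fun Q : ProbabilityMeasure Xi => Rrisk Lf θ Q) ''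
      {Q | Q ∈ PiSet psi E ∧
        relEntropy (P' : Measure Xi) (Q : Measure Xi) ≤ ENNReal.ofReal r} :=
    ⟨P', ⟨hP', by simp [relEntropy_self]⟩, rfl⟩
  exact ⟨le_csSup ⟨_, hub⟩ hself, csSup_le ⟨_, hself⟩ hub⟩

end
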